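/- From null to Cartesian coordinates (Corollary 2.19). Let α, β ∈ ℝ∖{0,1} and γ ∈ ℝ, let F: ℝ² → ℝ be C_b^∞, and define f: ℝ² → ℝ by f(t,x) := F(x−t, x+t). Assume either (i) γ ≤ min(α, β) and α + β > 1, or (ii) γ ≤ min(α, β, α+β) and P_M^u P_N^v F = 0 for all pairs of dyadic scales with M ∼ N. Then sup_{t∈ℝ} ‖f(t,·)‖_{C^γ} + sup_{t∈ℝ} ‖∂_t f(t,·)‖_{C^{γ−1}} ≤ C‖F‖_{C_u^{α}C_v^{β}}, with a constant C depending only on α, β, γ. -/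

import Mathlib

noncomputable section

open Real MeasureTheory
open scoped ENNReal Classical NNReal

/-- A function between real normed spaces is `C_b^∞`: it is smooth and it together with all of
its iterated derivatives is bounded. -/
def CbSmooth {E F : Type*} [NormedAddCommGroup E] [NormedSpace ℝ E]
    [NormedAddCommGroup F] [NormedSpace ℝ F] (f : E → F) : Prop :=
  ContDiff ℝ (⊤ : ℕ∞) f ∧ ∀ n : ℕ, ∃ C : ℝ, ∀ x : E, ‖iteratedFDeriv ℝ n f x‖ ≤ C

/-- An admissible Littlewood–Paley cutoff: a smooth even `[0,1]`-valued function which is `≡ 1`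
on `{|ξ| ≤ 7/8}` and vanishes on `{|ξ| ≥ 9/8}`. -/
structure IsLPCutoff (ρ : ℝ → ℝ) : Prop where
  smooth : ContDiff ℝ (⊤ : ℕ∞) ρ
  nonneg : ∀ ξ, 0 ≤ ρ ξ
  le_one : ∀ ξ, ρ ξ ≤ 1
  even : ∀ ξ, ρ (-ξ) = ρ ξ
  eq_one : ∀ ξ : ℝ, |ξ| ≤ 7 / 8 → ρ ξ = 1
  eq_zero : ∀ ξ : ℝ, 9 / 8 ≤ |ξ| → ρ ξ = 0

/-- The Littlewood–Paley symbol `ρ_N` at the dyadic scale `N = 2 ^ k`. -/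
def lpSymbol (ρ : ℝ → ℝ) : ℕ → ℝ → ℝ
  | 0 => ρ
  | k + 1 => fun ξ => ρ (ξ / 2 ^ (k + 1)) - ρ (2 * ξ / 2 ^ (k + 1))

/-- The inverse Fourier transform `(2π)^{-1/2} ∫ e^{ixξ} g(ξ) dξ` of a real even function,
written as a cosine transform. -/
def invFourier (g : ℝ → ℝ) (x : ℝ) : ℝ :=
  (Real.sqrt (2 * Real.pi))⁻¹ * ∫ ξ : ℝ, Real.cos (x * ξ) * g ξ

/-- The Littlewood–Paley convolution kernel `ρ̌_N`, `N = 2 ^ k`. -/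
def lpKernel (ρ : ℝ → ℝ) (k : ℕ) : ℝ → ℝ :=
  invFourier (lpSymbol ρ k)

/-- The Littlewood–Paley projection `P_N f = ρ̌_N ∗ f`, `N = 2 ^ k`. -/
def LP (ρ : ℝ → ℝ) (k : ℕ) (f : ℝ → ℝ) (x : ℝ) : ℝ :=
  ∫ y : ℝ, lpKernel ρ k y * f (x - y)

/-- The Littlewood–Paley projection in the first variable. -/
def LPu (ρ : ℝ → ℝ) (k : ℕ) (F : ℝ × ℝ → ℝ) (p : ℝ × ℝ) : ℝ :=
  ∫ y : ℝ, lpKernel ρ k y * F (p.1 - y, p.2)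

/-- The Littlewood–Paley projection in the second variable. -/
def LPv (ρ : ℝ → ℝ) (k : ℕ) (F : ℝ × ℝ → ℝ) (p : ℝ × ℝ) : ℝ :=
  ∫ y : ℝ, lpKernel ρ k y * F (p.1, p.2 - y)

/-- The Hölder norm `‖f‖_{C^γ} = sup_N N^γ ‖P_N f‖_{L^∞}`, valued in `[0,∞]`. -/
def hNorm (ρ : ℝ → ℝ) (γ : ℝ) (f : ℝ → ℝ) : ℝ≥0∞ :=
  ⨆ k : ℕ, ENNReal.ofReal (((2 : ℝ) ^ k) ^ γ) * ⨆ x : ℝ, ENNReal.ofReal |LP ρ k f x|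

/-- The product Hölder norm `‖F‖_{C_u^{γ₁} C_v^{γ₂}}`, valued in `[0,∞]`. -/
def hNorm2 (ρ : ℝ → ℝ) (γ₁ γ₂ : ℝ) (F : ℝ × ℝ → ℝ) : ℝ≥0∞ :=
  ⨆ k₁ : ℕ, ⨆ k₂ : ℕ,
    ENNReal.ofReal (((2 : ℝ) ^ k₁) ^ γ₁ * ((2 : ℝ) ^ k₂) ^ γ₂) *
      ⨆ p : ℝ × ℝ, ENNReal.ofReal |LPu ρ k₁ (LPv ρ k₂ F) p|

/-- `2 ^ k₁ ∼ 2 ^ k₂`: comparable dyadic scales. -/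
def DClose (k₁ k₂ : ℕ) : Prop :=
  (2 : ℝ) ^ k₂ / 2 ^ 10 < (2 : ℝ) ^ k₁ ∧ (2 : ℝ) ^ k₁ < 2 ^ 10 * (2 : ℝ) ^ k₂

/-- `2 ^ k₁ ≪ 2 ^ k₂`. -/
def DLow (k₁ k₂ : ℕ) : Prop := (2 : ℝ) ^ k₁ ≤ (2 : ℝ) ^ k₂ / 2 ^ 10

/-- `2 ^ k₁ ≳ 2 ^ k₂`. -/
def DGtr (k₁ k₂ : ℕ) : Prop := (2 : ℝ) ^ k₂ ≤ 2 ^ 10 * (2 : ℝ) ^ k₁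


structure GoodSym (g : ℝ → ℝ) : Prop where
  smooth : ContDiff ℝ (⊤ : ℕ∞) g
  supp : HasCompactSupport g
  even : ∀ ξ, g (-ξ) = g ξ

/-- the constant `√(2π)` -/
def s2p : ℝ := Real.sqrt (2 * Real.pi)

lemma s2p_pos : 0 < s2p := by unfold s2p; positivity

lemma s2p_sq : s2p * s2p = 2 * Real.pi := by
  unfold s2p; exact Real.mul_self_sqrt (by positivity)

lemma GoodSym.integrable {g : ℝ → ℝ} (hg : GoodSym g) : Integrable g :=
  hg.smooth.continuous.integrable_of_hasCompactSupport hg.supp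

lemma integral_sin_even {g : ℝ → ℝ} (hg : ∀ ξ, g (-ξ) = g ξ) (x : ℝ) :
    ∫ ξ : ℝ, Real.sin (x * ξ) * g ξ = 0 := by
  have h := integral_neg_eq_self (fun ξ : ℝ => Real.sin (x * ξ) * g ξ) volume
  have h2 : (fun ξ : ℝ => Real.sin (x * -ξ) * g (-ξ)) = fun ξ => -(Real.sin (x * ξ) * g ξ) := by
    funext ξ; rw [hg, mul_neg, Real.sin_neg]; ring
  simp only [h2, integral_neg] at h
  linarith

open FourierTransform in
lemma GoodSym.exists_schwartz {g : ℝ → ℝ} (hg : GoodSym g) :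
    ∃ S : SchwartzMap ℝ ℂ, (∀ v, S v = ((s2p * g (2 * π * v) : ℝ) : ℂ)) ∧
      ∀ y, (𝓕 S) y = (invFourier g y : ℂ) := by
  have hsm : ContDiff ℝ (⊤ : ℕ∞) (fun v : ℝ => ((s2p * g (2 * π * v) : ℝ) : ℂ)) := by
    refine Complex.ofRealCLM.contDiff.comp ?_
    exact contDiff_const.mul (hg.smooth.comp (contDiff_const.mul contDiff_id))
  have hcs : HasCompactSupport (fun v : ℝ => ((s2p * g (2 * π * v) : ℝ) : ℂ)) := by
    have h1 : HasCompactSupport (fun v : ℝ => g (2 * π * v)) :=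
      hg.supp.comp_homeomorph (Homeomorph.mulLeft₀ (2 * π) (by positivity))
    have h2 : HasCompactSupport (fun v : ℝ => s2p * g (2 * π * v)) := h1.mul_left
    exact h2.comp_left (g := fun x : ℝ => (x : ℂ)) (by simp)
  refine ⟨hcs.toSchwartzMap hsm, fun v => rfl, fun y => ?_⟩
  rw [SchwartzMap.fourier_coe, Real.fourier_real_eq_integral_exp_smul]
  have e1 : ∀ v : ℝ, Complex.exp (↑(-2 * π * v * y) * Complex.I) • (hcs.toSchwartzMap hsm) v
      = (fun ξ : ℝ => (s2p : ℂ) * (((Real.cos (y * ξ) * g ξ : ℝ) : ℂ)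
        - ((Real.sin (y * ξ) * g ξ : ℝ) : ℂ) * Complex.I)) (2 * π * v) := by
    intro v
    change _ • (((s2p * g (2 * π * v) : ℝ) : ℂ)) = _
    have : (↑(-2 * π * v * y) : ℂ) = ((-(y * (2 * π * v)) : ℝ) : ℂ) := by push_cast; ring
    rw [this, Complex.exp_mul_I, ← Complex.ofReal_cos, ← Complex.ofReal_sin, Real.cos_neg,
      Real.sin_neg]
    push_cast
    simp only [smul_eq_mul]
    ring
  simp_rw [e1]
  rw [Measure.integral_comp_mul_left (fun ξ : ℝ => (s2p : ℂ) * (((Real.cos (y * ξ) * g ξ : ℝ) : ℂ)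
        - ((Real.sin (y * ξ) * g ξ : ℝ) : ℂ) * Complex.I)) (2 * π)]
  have i1 : Integrable (fun ξ => Real.cos (y * ξ) * g ξ) :=
    hg.integrable.bdd_mul (c := 1) (by fun_prop) (Filter.Eventually.of_forall fun ξ => by
      simpa using Real.abs_cos_le_one _)
  have i2 : Integrable (fun ξ => Real.sin (y * ξ) * g ξ) :=
    hg.integrable.bdd_mul (c := 1) (by fun_prop) (Filter.Eventually.of_forall fun ξ => by
      simpa using Real.abs_sin_le_one _)
  rw [integral_const_mul, integral_sub i1.ofReal (i2.ofReal.mul_const _), integral_mul_const]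
  have a1 : ∫ ξ : ℝ, ((Real.cos (y * ξ) * g ξ : ℝ) : ℂ) = ((∫ ξ : ℝ, Real.cos (y * ξ) * g ξ : ℝ) : ℂ) :=
    integral_ofReal
  have a2 : ∫ ξ : ℝ, ((Real.sin (y * ξ) * g ξ : ℝ) : ℂ) = ((∫ ξ : ℝ, Real.sin (y * ξ) * g ξ : ℝ) : ℂ) :=
    integral_ofReal
  rw [a1, a2, integral_sin_even hg.even]
  unfold invFourier
  rw [← s2p] 
  have h3 : |(2 * π)⁻¹| * s2p = s2p⁻¹ := by
    rw [abs_of_pos (by positivity), ← s2p_sq]; field_simp [s2p_pos.ne']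
  rw [← h3]
  simp
  ring

lemma GoodSym.continuous {g : ℝ → ℝ} (hg : GoodSym g) : Continuous (invFourier g) := by
  obtain ⟨S, -, h⟩ := hg.exists_schwartz
  have : invFourier g = fun y => (FourierTransform.fourier S y).re := by
    funext y; rw [h]; simp
  rw [this]
  exact Complex.continuous_re.comp (FourierTransform.fourier S).continuous

lemma GoodSym.integrable_ker {g : ℝ → ℝ} (hg : GoodSym g) : Integrable (invFourier g) := by
  obtain ⟨S, -, h⟩ := hg.exists_schwartz
  have : invFourier g = fun y => (FourierTransform.fourier S y).re := by
    funext y; rw [h]; simp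
  rw [this]
  exact (FourierTransform.fourier S).integrable.re

lemma GoodSym.exists_deriv {g : ℝ → ℝ} (hg : GoodSym g) :
    ∃ d : ℝ → ℝ, Integrable d ∧ ∀ x, HasDerivAt (invFourier g) (d x) x := by
  obtain ⟨S, -, h⟩ := hg.exists_schwartz
  have : invFourier g = fun y => (FourierTransform.fourier S y).re := by
    funext y; rw [h]; simp
  refine ⟨fun x => (SchwartzMap.derivCLM ℝ ℂ (FourierTransform.fourier S) x).re,
    (SchwartzMap.derivCLM ℝ ℂ (FourierTransform.fourier S)).integrable.re, fun x => ?_⟩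
  rw [this]
  have := (FourierTransform.fourier S : SchwartzMap ℝ ℂ).hasDerivAt x
  exact (Complex.reCLM.hasFDerivAt.comp_hasDerivAt x this)

lemma GoodSym.bounded {g : ℝ → ℝ} (hg : GoodSym g) : ∃ M, ∀ x, |invFourier g x| ≤ M := by
  refine ⟨(Real.sqrt (2 * Real.pi))⁻¹ * ∫ ξ, |g ξ|, fun x => ?_⟩
  unfold invFourier
  rw [abs_mul, abs_of_nonneg (by positivity : 0 ≤ (Real.sqrt (2 * Real.pi))⁻¹)]
  refine mul_le_mul_of_nonneg_left ?_ (by positivity)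
  rw [← Real.norm_eq_abs]
  refine norm_integral_le_of_norm_le hg.integrable.abs (Filter.Eventually.of_forall fun ξ => ?_)
  rw [Real.norm_eq_abs, abs_mul]
  exact mul_le_of_le_one_left (abs_nonneg _) (Real.abs_cos_le_one _)

/-- Fourier inversion in real form. -/
lemma GoodSym.inversion {g : ℝ → ℝ} (hg : GoodSym g) (θ η : ℝ) :
    ∫ y, invFourier g y * Real.cos (θ - y * η) = s2p * g η * Real.cos θ := by
  obtain ⟨S, hS, h⟩ := hg.exists_schwartz
  have e : FourierTransformInv.fourierInv (FourierTransform.fourier S) (η / (2 * π)) =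
      S (η / (2 * π)) := by simp
  rw [SchwartzMap.fourierInv_coe, Real.fourierInv_eq', hS] at e
  have hη : 2 * π * (η / (2 * π)) = η := by field_simp
  rw [hη] at e
  have e2 : ∀ y : ℝ, Complex.exp (↑(2 * π * inner ℝ y (η / (2 * π))) * Complex.I) •
      (FourierTransform.fourier S) y = Complex.exp (↑(y * η) * Complex.I) * (invFourier g y : ℂ) := by
    intro y
    rw [h, smul_eq_mul]
    congr 4
    simp
    field_simp
  simp_rw [e2] at e
  have int : Integrable (fun y : ℝ => Complex.exp (↑(y * η) * Complex.I) * (invFourier g y : ℂ)) := by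
    refine hg.integrable_ker.ofReal.bdd_mul (c := 1) (by fun_prop) 
      (Filter.Eventually.of_forall fun ξ => ?_)
    rw [Complex.norm_exp_ofReal_mul_I]
  have e3 : ∀ y : ℝ, invFourier g y * Real.cos (θ - y * η) =
      (Complex.exp (↑(-θ) * Complex.I) * 
        (Complex.exp (↑(y * η) * Complex.I) * (invFourier g y : ℂ))).re := by
    intro y
    rw [← mul_assoc, ← Complex.exp_add, ← add_mul, ← Complex.ofReal_add, Complex.re_mul_ofReal,
      Complex.exp_ofReal_mul_I_re, mul_comm, ← Real.cos_neg]
    congr 2; ring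
  simp_rw [e3]
  have := integral_re (𝕜 := ℂ) (int.const_mul (Complex.exp (↑(-θ) * Complex.I)))
  simp only [RCLike.re_to_complex] at this
  rw [this, integral_const_mul, e, Complex.re_mul_ofReal, Complex.exp_ofReal_mul_I_re, Real.cos_neg,
    mul_comm]

lemma fubini_ker {g : ℝ → ℝ} (hg : GoodSym g) {f : ℝ → ℝ} (hf : Integrable f) (b : ℝ) :
    ∫ y, f y * invFourier g (b - y) =
      s2p⁻¹ * ∫ w, g w * ∫ y, f y * Real.cos ((b - y) * w) := by
  have hintg : Integrable (Function.uncurry fun (y w : ℝ) => f y * (Real.cos ((b - y) * w) * g w))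
      (volume.prod volume) := by
    have h1 := hf.mul_prod hg.integrable
    have h2 : Integrable (fun p : ℝ × ℝ => Real.cos ((b - p.1) * p.2) * (f p.1 * g p.2))
      (volume.prod volume) :=
      h1.bdd_mul (c := 1) (by fun_prop) (Filter.Eventually.of_forall fun ξ => by
        simpa using Real.abs_cos_le_one _)
    refine h2.congr (Filter.Eventually.of_forall fun p => ?_)
    simp only [Function.uncurry]; ring
  have e1 : ∀ y, f y * invFourier g (b - y) =
      s2p⁻¹ * ∫ w, f y * (Real.cos ((b - y) * w) * g w) := by
    intro y
    rw [integral_const_mul]; unfold invFourier; rw [← s2p]; ring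
  simp_rw [e1]
  rw [integral_const_mul, integral_integral_swap hintg]
  congr 1
  refine integral_congr_ae (Filter.Eventually.of_forall fun w => ?_)
  simp only
  rw [← integral_const_mul]
  refine integral_congr_ae (Filter.Eventually.of_forall fun y => ?_)
  simp only
  ring

lemma conv_ker {g h : ℝ → ℝ} (hg : GoodSym g) (hh : GoodSym h) (x : ℝ) :
    ∫ y, invFourier g y * invFourier h (x - y) =
      s2p * invFourier (fun ξ => g ξ * h ξ) x := by
  rw [fubini_ker hh hg.integrable_ker x]
  have : ∀ w, h w * ∫ y, invFourier g y * Real.cos ((x - y) * w) =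
      s2p * (Real.cos (x * w) * (g w * h w)) := by
    intro w
    have := hg.inversion (x * w) w
    simp_rw [sub_mul]
    rw [this]; ring
  simp_rw [this]
  rw [integral_const_mul]
  unfold invFourier
  rw [← s2p]; ring

lemma triple_ker {g h l : ℝ → ℝ} (hg : GoodSym g) (hh : GoodSym h) (hl : GoodSym l)
    (hz : ∀ v w, h v ≠ 0 → l w ≠ 0 → g (v + w) = 0) (a b : ℝ) :
    ∫ y, invFourier g y * invFourier h (a - y) * invFourier l (b - y) = 0 := by
  have i1 : Integrable (fun y => invFourier g y * invFourier h (a - y)) := by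
    obtain ⟨M, hM⟩ := hh.bounded
    have := hg.integrable_ker.bdd_mul (f := fun y => invFourier h (a - y)) (c := M)
      (hh.continuous.comp (by fun_prop)).aestronglyMeasurable
      (Filter.Eventually.of_forall fun ξ => hM _)
    refine this.congr (Filter.Eventually.of_forall fun p => mul_comm _ _)
  rw [fubini_ker hl i1 b]
  have i2 : ∀ w, Integrable (fun y => invFourier g y * Real.cos ((b - y) * w)) := by
    intro w
    have := hg.integrable_ker.bdd_mul (f := fun y => Real.cos ((b - y) * w)) (c := 1)
      (by fun_prop)
      (Filter.Eventually.of_forall fun ξ => by simpa using Real.abs_cos_le_one _)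
    refine this.congr (Filter.Eventually.of_forall fun p => mul_comm _ _)
  have z : ∀ w, l w * ∫ y, invFourier g y * invFourier h (a - y) * Real.cos ((b - y) * w) = 0 := by
    intro w
    by_cases hw : l w = 0
    · simp [hw]
    have e : ∀ y, invFourier g y * invFourier h (a - y) * Real.cos ((b - y) * w) =
      (invFourier g y * Real.cos ((b - y) * w)) * invFourier h (a - y) := fun y => by ring
    simp_rw [e]
    rw [fubini_ker hh (i2 w) a]
    have z2 : ∀ v, h v * ∫ y, invFourier g y * Real.cos ((b - y) * w) * Real.cos ((a - y) * v) = 0 := by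
      intro v
      by_cases hv : h v = 0
      · simp [hv]
      have hw' : l (-w) ≠ 0 := by rwa [hl.even]
      have e3 : ∀ y, invFourier g y * Real.cos ((b - y) * w) * Real.cos ((a - y) * v) =
          1 / 2 * (invFourier g y * Real.cos ((a * v + b * w) - y * (v + w))) +
          1 / 2 * (invFourier g y * Real.cos ((a * v + b * -w) - y * (v + -w))) := by
        intro y
        have c1 := Real.cos_add ((a - y) * v) ((b - y) * w)
        have c2 := Real.cos_sub ((a - y) * v) ((b - y) * w)
        rw [show (a * v + b * w) - y * (v + w) = (a - y) * v + (b - y) * w by ring,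
          show (a * v + b * -w) - y * (v + -w) = (a - y) * v - (b - y) * w by ring, c1, c2]
        ring
      have i3 : ∀ θ η, Integrable (fun y => 1 / 2 * (invFourier g y * Real.cos (θ - y * η))) := by
        intro θ η
        have := hg.integrable_ker.bdd_mul (f := fun y => Real.cos (θ - y * η)) (c := 1)
          (by fun_prop)
          (Filter.Eventually.of_forall fun ξ => by simpa using Real.abs_cos_le_one _)
        refine (this.congr (Filter.Eventually.of_forall fun p => mul_comm _ _)).const_mul _
      simp_rw [e3]
      rw [integral_add (i3 _ _) (i3 _ _), integral_const_mul, integral_const_mul, hg.inversion,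
        hg.inversion, hz v w hv hw, hz v (-w) hv hw']
      simp
    simp [z2]
  simp [z]

lemma GoodSym.dilate {g : ℝ → ℝ} (hg : GoodSym g) {l : ℝ} (hl : 0 < l) :
    GoodSym (fun ξ => g (ξ / l)) where
  smooth := hg.smooth.comp (contDiff_id.div_const l)
  supp := by
    have := hg.supp.comp_homeomorph (Homeomorph.mulRight₀ l⁻¹ (by positivity))
    exact this
  even ξ := by rw [neg_div, hg.even]

lemma invFourier_dilate (g : ℝ → ℝ) {l : ℝ} (hl : 0 < l) (y : ℝ) :
    invFourier (fun ξ => g (ξ / l)) y = l * invFourier g (l * y) := by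
  unfold invFourier
  have := Measure.integral_comp_div (fun ξ : ℝ => Real.cos (l * y * ξ) * g ξ) l
  rw [abs_of_pos hl, smul_eq_mul] at this
  have e : ∀ ξ, Real.cos (l * y * (ξ / l)) * g (ξ / l) = Real.cos (y * ξ) * g (ξ / l) := by
    intro ξ; congr 2; field_simp
  simp_rw [e] at this
  rw [this]; ring

lemma L1_dilate (k : ℝ → ℝ) {l : ℝ} (hl : 0 < l) :
    ∫ y, |l * k (l * y)| = ∫ y, |k y| := by
  have := Measure.integral_comp_mul_left (fun y : ℝ => |k y|) l
  simp_rw [abs_mul, abs_of_pos hl]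
  rw [integral_const_mul, this, abs_of_pos (by positivity), smul_eq_mul]
  field_simp


lemma IsLPCutoff.good {ρ : ℝ → ℝ} (hρ : IsLPCutoff ρ) : GoodSym ρ where
  smooth := hρ.smooth
  even := hρ.even
  supp := by
    refine HasCompactSupport.intro (K := Metric.closedBall 0 (9/8)) (isCompact_closedBall _ _) ?_
    intro x hx
    apply hρ.eq_zero
    simp [Metric.mem_closedBall] at hx
    exact hx.le

lemma good_chi {ρ : ℝ → ℝ} (hρ : IsLPCutoff ρ) : GoodSym (fun ξ => ρ ξ - ρ (2 * ξ)) where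
  smooth := hρ.smooth.sub (hρ.smooth.comp (contDiff_const.mul contDiff_id))
  even ξ := by rw [mul_neg, hρ.even, hρ.even]
  supp := by
    have := hρ.good.supp.comp_homeomorph (Homeomorph.mulLeft₀ (2 : ℝ) (by positivity))
    exact hρ.good.supp.sub this

lemma lpSymbol_succ {ρ : ℝ → ℝ} (k : ℕ) :
    lpSymbol ρ (k + 1) = fun ξ => (fun ξ => ρ ξ - ρ (2 * ξ)) (ξ / 2 ^ (k + 1)) := by
  funext ξ
  simp only [lpSymbol]
  rw [mul_div_assoc]

lemma good_lp {ρ : ℝ → ℝ} (hρ : IsLPCutoff ρ) (k : ℕ) : GoodSym (lpSymbol ρ k) := by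
  cases k with
  | zero => exact hρ.good
  | succ k => rw [lpSymbol_succ]; exact (good_chi hρ).dilate (by positivity)

lemma lp_supp_le {ρ : ℝ → ℝ} (hρ : IsLPCutoff ρ) (k : ℕ) {ξ : ℝ} (h : lpSymbol ρ k ξ ≠ 0) : |ξ| < 9 / 8 * 2 ^ k := by
  by_contra hc
  push Not at hc
  apply h
  cases k with
  | zero => apply hρ.eq_zero; simpa using hc
  | succ k =>
    simp only [lpSymbol]
    have hp : (0:ℝ) < 2 ^ (k + 1) := by positivity
    rw [hρ.eq_zero, hρ.eq_zero, sub_zero]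
    · rw [abs_div, abs_of_pos hp, le_div_iff₀ hp, abs_mul, abs_two]; nlinarith [abs_nonneg ξ]
    · rw [abs_div, abs_of_pos hp, le_div_iff₀ hp]; exact hc

lemma lp_supp_ge {ρ : ℝ → ℝ} (hρ : IsLPCutoff ρ) (k : ℕ) (hk : 1 ≤ k) {ξ : ℝ} (h : lpSymbol ρ k ξ ≠ 0) : 7 / 16 * 2 ^ k < |ξ| := by
  by_contra hc
  push Not at hc
  apply h
  cases k with
  | zero => omega
  | succ k =>
    simp only [lpSymbol]
    have hp : (0:ℝ) < 2 ^ (k + 1) := by positivity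
    rw [hρ.eq_one, hρ.eq_one, sub_self]
    · rw [abs_div, abs_of_pos hp, div_le_iff₀ hp, abs_mul, abs_two]; linarith
    · rw [abs_div, abs_of_pos hp, div_le_iff₀ hp]; linarith

/-- uniform `L¹` bound of the kernels -/
lemma ker_L1 {ρ : ℝ → ℝ} : ∃ C : ℝ, 0 < C ∧ ∀ k, ∫ y, |lpKernel ρ k y| ≤ C := by
  refine ⟨(∫ y, |invFourier ρ y|) + (∫ y, |invFourier (fun ξ => ρ ξ - ρ (2 * ξ)) y|) + 1, ?_, ?_⟩
  · positivity
  · intro k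
    have p1 : 0 ≤ ∫ y, |invFourier ρ y| := by positivity
    have p2 : 0 ≤ ∫ y, |invFourier (fun ξ => ρ ξ - ρ (2 * ξ)) y| := by positivity
    cases k with
    | zero =>
      have : lpKernel ρ 0 = invFourier ρ := rfl
      rw [this]; linarith
    | succ k =>
      have : ∀ y, lpKernel ρ (k + 1) y = 2 ^ (k + 1) *
          invFourier (fun ξ => ρ ξ - ρ (2 * ξ)) (2 ^ (k + 1) * y) := by
        intro y
        unfold lpKernel
        rw [lpSymbol_succ]
        exact invFourier_dilate (fun ξ => ρ ξ - ρ (2 * ξ)) (by positivity) y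
      simp_rw [this]
      rw [L1_dilate _ (by positivity)]; linarith

lemma invFourier_sub {g h : ℝ → ℝ} (hg : GoodSym g) (hh : GoodSym h) (y : ℝ) :
    invFourier (fun ξ => g ξ - h ξ) y = invFourier g y - invFourier h y := by
  unfold invFourier
  have i : ∀ {g : ℝ → ℝ}, GoodSym g → Integrable (fun ξ => Real.cos (y * ξ) * g ξ) := fun hg =>
    hg.integrable.bdd_mul (c := 1) (by fun_prop) (Filter.Eventually.of_forall fun ξ => by
      simpa using Real.abs_cos_le_one _)
  simp_rw [mul_sub]
  rw [integral_sub (i hg) (i hh), mul_sub]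

lemma ker_sum {ρ : ℝ → ℝ} (hρ : IsLPCutoff ρ) (L : ℕ) (y : ℝ) :
    ∑ k ∈ Finset.range (L + 1), lpKernel ρ k y = 2 ^ L * invFourier ρ (2 ^ L * y) := by
  induction L with
  | zero => simp [lpKernel, lpSymbol]
  | succ L ih =>
    rw [Finset.sum_range_succ, ih, ← invFourier_dilate ρ (by positivity),
      ← invFourier_dilate ρ (by positivity)]
    unfold lpKernel
    have : lpSymbol ρ (L + 1) = fun ξ => ρ (ξ / 2 ^ (L + 1)) - ρ (ξ / 2 ^ L) := by
      funext ξ; simp only [lpSymbol]; congr 2; rw [pow_succ]; field_simp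
    rw [this, invFourier_sub (hρ.good.dilate (by positivity)) (hρ.good.dilate (by positivity))]
    ring

lemma int_phi {ρ : ℝ → ℝ} (hρ : IsLPCutoff ρ) : ∫ y, invFourier ρ y = s2p := by
  have := hρ.good.inversion 0 0
  simpa [hρ.eq_one 0 (by norm_num)] using this

/-- reproducing kernel identity -/
lemma ker_repr {ρ : ℝ → ℝ} (hρ : IsLPCutoff ρ) (m : ℕ) (x : ℝ) :
    ∫ y, (2 ^ (m + 1) * invFourier ρ (2 ^ (m + 1) * y)) * lpKernel ρ m (x - y) =
      s2p * lpKernel ρ m x := by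
  simp_rw [← invFourier_dilate ρ (show (0:ℝ) < 2 ^ (m + 1) by positivity)]
  unfold lpKernel
  rw [conv_ker (hρ.good.dilate (by positivity)) (good_lp hρ m)]
  congr 2
  funext ξ
  by_cases h : lpSymbol ρ m ξ = 0
  · simp [h]
  · rw [hρ.eq_one, one_mul]
    have hp : (0:ℝ) < 2 ^ (m + 1) := by positivity
    rw [abs_div, abs_of_pos hp, div_le_iff₀ hp, pow_succ]
    have := lp_supp_le hρ m h
    have : (0:ℝ) < 2 ^ m := by positivity
    linarith

/-- frequency incompatibility -/
lemma triple_zero {ρ : ℝ → ℝ} (hρ : IsLPCutoff ρ) {K m n : ℕ}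
    (h : (m + 2 < K ∧ n + 2 < K) ∨ (n + 10 ≤ m ∧ K + 1 < m) ∨ (m + 10 ≤ n ∧ K + 1 < n)) (a b : ℝ) :
    ∫ y, lpKernel ρ K y * lpKernel ρ m (a - y) * lpKernel ρ n (b - y) = 0 := by
  refine triple_ker (good_lp hρ K) (good_lp hρ m) (good_lp hρ n) ?_ a b
  intro v w hv hw
  by_contra hc
  have v1 := lp_supp_le hρ m hv
  have w1 := lp_supp_le hρ n hw
  have z1 := lp_supp_le hρ K hc
  have pw : ∀ {i j c : ℕ}, i + c ≤ j → (2:ℝ) ^ i * 2 ^ c ≤ 2 ^ j := fun {i j c} h => by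
    rw [← pow_add]; exact pow_le_pow_right₀ (by norm_num) h
  have pp : ∀ i : ℕ, (0:ℝ) < 2 ^ i := fun i => by positivity
  rcases h with ⟨h1, h2⟩ | ⟨h1, h2⟩ | ⟨h1, h2⟩
  · have z2 := lp_supp_ge hρ K (by omega) hc
    have a1 := pw (show m + 3 ≤ K by omega)
    have a2 := pw (show n + 3 ≤ K by omega)
    have := abs_add_le v w
    linarith [pp K]
  · have v2 := lp_supp_ge hρ m (by omega) hv
    have a1 := pw (show n + 10 ≤ m by omega)
    have a2 := pw (show K + 2 ≤ m by omega)
    have := abs_sub_abs_le_abs_sub v (-w)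
    rw [sub_neg_eq_add, abs_neg] at this
    linarith [pp m]
  · have w2 := lp_supp_ge hρ n (by omega) hw
    have a1 := pw (show m + 10 ≤ n by omega)
    have a2 := pw (show K + 2 ≤ n by omega)
    have := abs_sub_abs_le_abs_sub w (-v)
    rw [sub_neg_eq_add, abs_neg, add_comm] at this
    linarith [pp n]


/-- bounded continuous functions -/
def BC {X : Type*} [TopologicalSpace X] (H : X → ℝ) : Prop :=
  Continuous H ∧ ∃ M, ∀ p, |H p| ≤ M

lemma BC.comp {X Y : Type*} [TopologicalSpace X] [TopologicalSpace Y] {H : X → ℝ} (h : BC H)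
    {s : Y → X} (hs : Continuous s) : BC (fun y => H (s y)) :=
  ⟨h.1.comp hs, h.2.imp fun _ hM _ => hM _⟩

lemma int_ker_bc {κ h : ℝ → ℝ} (hκ : Integrable κ) (hh : BC h) : Integrable (fun y => κ y * h y) := by
  obtain ⟨hc, M, hM⟩ := hh
  exact (hκ.bdd_mul (c := M) hc.aestronglyMeasurable (Filter.Eventually.of_forall fun ξ => hM ξ)).congr
    (Filter.Eventually.of_forall fun y => mul_comm _ _)

lemma int_bd {κ h : ℝ → ℝ} (hκ : Integrable κ) {M : ℝ} (hM : ∀ y, |h y| ≤ M) :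
    |∫ y, κ y * h y| ≤ (∫ y, |κ y|) * M := by
  rw [← Real.norm_eq_abs, ← integral_mul_const]
  refine norm_integral_le_of_norm_le (hκ.abs.mul_const M) (Filter.Eventually.of_forall fun y => ?_)
  rw [Real.norm_eq_abs, abs_mul]
  exact mul_le_mul_of_nonneg_left (hM y) (abs_nonneg _)

lemma BC.integral {X : Type*} [TopologicalSpace X] [FirstCountableTopology X] {κ : ℝ → ℝ}
    (hκ : Integrable κ) {H : X × ℝ → ℝ} (hH : BC H) : BC (fun x => ∫ y, κ y * H (x, y)) := by
  obtain ⟨hc, M, hM⟩ := hH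
  refine ⟨?_, (∫ y, |κ y|) * M, fun x => int_bd hκ fun y => hM _⟩
  refine continuous_of_dominated (bound := fun y => |κ y| * M) ?_ ?_ (hκ.abs.mul_const M) ?_
  · intro x
    exact hκ.aestronglyMeasurable.mul (hc.comp (by fun_prop)).aestronglyMeasurable
  · intro x
    refine Filter.Eventually.of_forall fun y => ?_
    rw [Real.norm_eq_abs, abs_mul]
    exact mul_le_mul_of_nonneg_left (hM _) (abs_nonneg _)
  · exact Filter.Eventually.of_forall fun y => continuous_const.mul (hc.comp (by fun_prop))

lemma ker_dct {κ : ℝ → ℝ} (hκ : Integrable κ) {h : ℕ → ℝ → ℝ} {l : ℝ → ℝ} {M : ℝ}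
    (hc : ∀ L, Continuous (h L)) (hM : ∀ L y, |h L y| ≤ M)
    (hl : ∀ y, Filter.Tendsto (fun L => h L y) Filter.atTop (nhds (l y))) :
    Filter.Tendsto (fun L => ∫ y, κ y * h L y) Filter.atTop (nhds (∫ y, κ y * l y)) := by
  refine tendsto_integral_of_dominated_convergence (fun y => |κ y| * M) ?_ (hκ.abs.mul_const M) ?_ ?_
  · intro L; exact hκ.aestronglyMeasurable.mul (hc L).aestronglyMeasurable
  · intro L
    refine Filter.Eventually.of_forall fun y => ?_
    rw [Real.norm_eq_abs, abs_mul]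
    exact mul_le_mul_of_nonneg_left (hM _ _) (abs_nonneg _)
  · exact Filter.Eventually.of_forall fun y => (hl y).const_mul _

lemma ker_deriv {κ : ℝ → ℝ} (hκ : Integrable κ) {f f' : ℝ × ℝ → ℝ} (hf : BC f) (hf' : BC f')
    (hd : ∀ x y, HasDerivAt (fun x => f (x, y)) (f' (x, y)) x) (x : ℝ) :
    HasDerivAt (fun x => ∫ y, κ y * f (x, y)) (∫ y, κ y * f' (x, y)) x := by
  obtain ⟨hc', M, hM⟩ := hf'
  refine (hasDerivAt_integral_of_dominated_loc_of_deriv_le (μ := volume)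
    (F := fun x y => κ y * f (x, y))
    (F' := fun x y => κ y * f' (x, y)) (bound := fun y => |κ y| * M) (s := Set.univ)
    Filter.univ_mem ?_ ?_ ?_ ?_ (hκ.abs.mul_const M) ?_).2
  · refine Filter.Eventually.of_forall fun x => ?_
    exact (int_ker_bc hκ (hf.comp (s := fun y => (x, y)) (by fun_prop))).aestronglyMeasurable
  · exact (int_ker_bc hκ (hf.comp (s := fun y => (x, y)) (by fun_prop)))
  · exact hκ.aestronglyMeasurable.mul (hc'.comp (by fun_prop)).aestronglyMeasurable
  · refine Filter.Eventually.of_forall fun y x _ => ?_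
    rw [Real.norm_eq_abs, abs_mul]
    exact mul_le_mul_of_nonneg_left (hM _) (abs_nonneg _)
  · exact Filter.Eventually.of_forall fun y x _ => (hd x y).const_mul _

lemma swap0 {f g : ℝ → ℝ} (hf : Integrable f) (hg : Integrable g) {W : ℝ × ℝ → ℝ} (hW : BC W) :
    ∫ y, f y * ∫ a, g a * W (y, a) = ∫ a, g a * ∫ y, f y * W (y, a) := by
  obtain ⟨hc, M, hM⟩ := hW
  have hintg : Integrable (Function.uncurry fun y a => f y * (g a * W (y, a)))
      (volume.prod volume) := by
    have h1 := hf.mul_prod hg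
    have h2 := h1.bdd_mul (f := W) (c := M) hc.aestronglyMeasurable
      (Filter.Eventually.of_forall fun ξ => hM ξ)
    refine h2.congr (Filter.Eventually.of_forall fun p => ?_)
    simp only [Function.uncurry]; ring
  simp_rw [← integral_const_mul]
  rw [integral_integral_swap hintg]
  refine integral_congr_ae (Filter.Eventually.of_forall fun a => ?_)
  refine integral_congr_ae (Filter.Eventually.of_forall fun y => ?_)
  simp only; ring

lemma swap1 {f g : ℝ → ℝ} (hf : Integrable f) (hg : Integrable g) {W : ℝ × ℝ → ℝ} (hW : BC W) :
    ∫ y, f y * ∫ a, g (a - y) * W (y, a) = ∫ a, ∫ y, f y * g (a - y) * W (y, a) := by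
  obtain ⟨hc, M, hM⟩ := hW
  have hintg : Integrable (Function.uncurry fun y a => f y * (g (a - y) * W (y, a)))
      (volume.prod volume) := by
    have h1 := (hf.convolution_integrand (ContinuousLinearMap.mul ℝ ℝ) hg).swap
    have h2 := h1.bdd_mul (f := W) (c := M) hc.aestronglyMeasurable
      (Filter.Eventually.of_forall fun ξ => hM ξ)
    refine h2.congr (Filter.Eventually.of_forall fun p => ?_)
    simp only [Function.uncurry, Function.comp, Prod.swap, ContinuousLinearMap.mul_apply']; ring
  simp_rw [← integral_const_mul]
  rw [integral_integral_swap hintg]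
  refine integral_congr_ae (Filter.Eventually.of_forall fun a => ?_)
  refine integral_congr_ae (Filter.Eventually.of_forall fun y => ?_)
  simp only; ring

lemma shift_int (g h : ℝ → ℝ) (y : ℝ) : ∫ a, g (a - y) * h (a - y) = ∫ a, g a * h a :=
  integral_sub_right_eq_self (fun a => g a * h a) y

lemma vanish {k k1 k2 : ℝ → ℝ} (hk : Integrable k) (h1 : Integrable k1) (h2 : Integrable k2)
    (b1 : BC k1) (hz : ∀ a b, ∫ y, k y * k1 (a - y) * k2 (b - y) = 0)
    {G : ℝ × ℝ → ℝ} (hG : BC G) (t x : ℝ) :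
    ∫ y, k y * ∫ a, k1 a * ∫ b, k2 b * G (x - y - t - a, x - y + t - b) = 0 := by
  have e1 : ∀ y, ∫ a, k1 a * ∫ b, k2 b * G (x - y - t - a, x - y + t - b) =
      ∫ a, k1 (a - y) * ∫ b, k2 b * G (x - t - a, x - y + t - b) := by
    intro y
    rw [← shift_int k1 _ y]
    refine integral_congr_ae (Filter.Eventually.of_forall fun a => ?_)
    simp only
    congr 3; funext b; congr 3; ring
  simp_rw [e1]
  have hW : BC (fun q : ℝ × ℝ => ∫ b, k2 b * G (x - t - q.2, x - q.1 + t - b)) :=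
    BC.integral h2 (H := fun r : (ℝ × ℝ) × ℝ => G (x - t - r.1.2, x - r.1.1 + t - r.2))
      (hG.comp (by fun_prop))
  have e2 := swap1 hk h1 hW
  simp only at e2
  rw [e2]
  have e3 : ∀ a, ∫ y, k y * k1 (a - y) * ∫ b, k2 b * G (x - t - a, x - y + t - b) = 0 := by
    intro a
    have i : Integrable (fun y => k y * k1 (a - y)) :=
      int_ker_bc hk (b1.comp (s := fun y => a - y) (by fun_prop))
    have e4 : ∀ y, ∫ b, k2 b * G (x - t - a, x - y + t - b) =
        ∫ b, k2 (b - y) * G (x - t - a, x + t - b) := by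
      intro y
      rw [← shift_int k2 _ y]
      refine integral_congr_ae (Filter.Eventually.of_forall fun a => ?_)
      simp only
      congr 3; ring
    simp_rw [e4]
    have e5 := swap1 i h2 (W := fun q => G (x - t - a, x + t - q.2)) (hG.comp (by fun_prop))
    simp only at e5
    rw [e5]
    have e6 : ∀ b, ∫ y, k y * k1 (a - y) * k2 (b - y) * G (x - t - a, x + t - b) = 0 := by
      intro b
      rw [integral_mul_const, hz, zero_mul]
    simp [e6]
  simp [e3]


lemma ker_int {ρ : ℝ → ℝ} (hρ : IsLPCutoff ρ) (k : ℕ) : Integrable (lpKernel ρ k) := (good_lp hρ k).integrable_ker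

lemma ker_bc {ρ : ℝ → ℝ} (hρ : IsLPCutoff ρ) (k : ℕ) : BC (lpKernel ρ k) := ⟨(good_lp hρ k).continuous, (good_lp hρ k).bounded⟩

lemma LPu_bc {ρ : ℝ → ℝ} (hρ : IsLPCutoff ρ) (k : ℕ) {G : ℝ × ℝ → ℝ} (hG : BC G) : BC (LPu ρ k G) :=
  BC.integral (ker_int hρ k) (H := fun r : (ℝ × ℝ) × ℝ => G (r.1.1 - r.2, r.1.2))
    (hG.comp (by fun_prop))

lemma LPv_bc {ρ : ℝ → ℝ} (hρ : IsLPCutoff ρ) (k : ℕ) {G : ℝ × ℝ → ℝ} (hG : BC G) : BC (LPv ρ k G) :=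
  BC.integral (ker_int hρ k) (H := fun r : (ℝ × ℝ) × ℝ => G (r.1.1, r.1.2 - r.2))
    (hG.comp (by fun_prop))

lemma LP_bc {ρ : ℝ → ℝ} (hρ : IsLPCutoff ρ) (k : ℕ) {G : ℝ → ℝ} (hG : BC G) : BC (LP ρ k G) :=
  BC.integral (ker_int hρ k) (H := fun r : ℝ × ℝ => G (r.1 - r.2))
    (hG.comp (by fun_prop))

lemma LP_vanish {ρ : ℝ → ℝ} (hρ : IsLPCutoff ρ) {K m n : ℕ}
    (h : (m + 2 < K ∧ n + 2 < K) ∨ (n + 10 ≤ m ∧ K + 1 < m) ∨ (m + 10 ≤ n ∧ K + 1 < n))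
    {G : ℝ × ℝ → ℝ} (hG : BC G) (t x : ℝ) :
    LP ρ K (fun x => LPu ρ m (LPv ρ n G) (x - t, x + t)) x = 0 :=
  vanish (ker_int hρ K) (ker_int hρ m) (ker_int hρ n) (ker_bc hρ m)
    (fun a b => triple_zero hρ h a b) hG t x

/-- Bernstein in one dimension -/
lemma bern1 {ρ : ℝ → ℝ} (hρ : IsLPCutoff ρ) : ∃ C : ℝ, 0 < C ∧ ∀ m : ℕ, ∃ D : ℝ → ℝ, Integrable D ∧ ∫ y, |D y| ≤ C * 2 ^ m ∧
    ∀ h h' : ℝ → ℝ, BC h → BC h' → (∀ x, HasDerivAt h (h' x) x) →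
      ∀ x, LP ρ m h' x = ∫ y, D y * LP ρ m h (x - y) := by
  obtain ⟨d, hdi, hd⟩ := hρ.good.exists_deriv
  have hs := s2p_pos
  refine ⟨s2p⁻¹ * 2 * (∫ y, |d y|) + 1, by positivity, fun m => ?_⟩
  set l : ℝ := 2 ^ (m + 1) with hl
  have lp : 0 < l := by positivity
  set Φ : ℝ → ℝ := fun y => l * invFourier ρ (l * y) with hΦ
  have Φi : Integrable Φ := ((integrable_comp_mul_left_iff _ lp.ne').2 hρ.good.integrable_ker).const_mul l
  set D0 : ℝ → ℝ := fun y => l * (l * d (l * y)) with hD0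
  have D0i : Integrable D0 :=
    (((integrable_comp_mul_left_iff _ lp.ne').2 hdi).const_mul l).const_mul l
  have hΦd : ∀ y, HasDerivAt Φ (D0 y) y := by
    intro y
    have h1 : HasDerivAt (fun y : ℝ => l * y) l y := by simpa using (hasDerivAt_id y).const_mul l
    have := ((hd (l * y)).comp y h1).const_mul l
    have e : D0 y = l * (d (l * y) * l) := by
      simp only [hD0]; ring
    rw [e]; exact this
  refine ⟨fun y => s2p⁻¹ * D0 y, D0i.const_mul _, ?_, ?_⟩
  · have : ∀ y, |s2p⁻¹ * D0 y| = s2p⁻¹ * l * |l * d (l * y)| := by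
      intro y
      simp only [hD0]
      rw [abs_mul, abs_mul l, abs_of_pos lp, abs_of_pos (inv_pos.2 hs)]; ring
    change ∫ y, |s2p⁻¹ * D0 y| ≤ _
    simp_rw [this]
    rw [integral_const_mul, L1_dilate _ lp, hl, pow_succ]
    have : (0:ℝ) < 2 ^ m := by positivity
    nlinarith
  · intro h h' bh bh' hh x
    have r1 : LP ρ m h' x = s2p⁻¹ * ∫ y, Φ y * LP ρ m h' (x - y) := by
      have e1 : ∀ y, LP ρ m h' (x - y) = ∫ a, lpKernel ρ m (a - y) * h' (x - a) := by
        intro y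
        unfold LP
        rw [← shift_int _ _ y]
        refine integral_congr_ae (Filter.Eventually.of_forall fun a => ?_)
        simp only
        congr 2; ring
      simp_rw [e1]
      have e2 := swap1 Φi (ker_int hρ m) (W := fun q => h' (x - q.2)) (bh'.comp (by fun_prop))
      simp only at e2
      rw [e2, ← integral_const_mul]
      unfold LP
      refine integral_congr_ae (Filter.Eventually.of_forall fun a => ?_)
      simp only
      rw [integral_mul_const, ker_repr hρ m a]
      field_simp
    have hq : ∀ x, HasDerivAt (LP ρ m h) (LP ρ m h' x) x := by
      intro x
      refine ker_deriv (ker_int hρ m) (f := fun q => h (q.1 - q.2)) (f' := fun q => h' (q.1 - q.2))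
        (bh.comp (by fun_prop)) (bh'.comp (by fun_prop)) ?_ x
      intro x y
      exact (hh (x - y)).comp_sub_const x y
    have bq := LP_bc hρ m bh
    have bq' := LP_bc hρ m bh'
    have ibp := integral_mul_deriv_eq_deriv_mul_of_integrable (u := Φ) (u' := D0)
      (v := fun y => LP ρ m h (x - y)) (v' := fun y => -LP ρ m h' (x - y))
      (fun y _ => hΦd y) (fun y _ => (hq (x - y)).comp_const_sub x y)
      (by
        have := (int_ker_bc Φi (bq'.comp (s := fun y => x - y) (by fun_prop))).neg
        refine this.congr (Filter.Eventually.of_forall fun y => ?_)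
        simp)
      (int_ker_bc D0i (bq.comp (s := fun y => x - y) (by fun_prop)))
      (int_ker_bc Φi (bq.comp (s := fun y => x - y) (by fun_prop)))
    simp only [mul_neg, integral_neg, neg_inj] at ibp
    rw [r1, ibp, ← integral_const_mul]
    simp_rw [mul_assoc]

lemma bern_u {ρ : ℝ → ℝ} (hρ : IsLPCutoff ρ) : ∃ C : ℝ, 0 < C ∧ ∀ (F Fu : ℝ × ℝ → ℝ), BC F → BC Fu →
    (∀ x y, HasDerivAt (fun a => F (a, y)) (Fu (x, y)) x) → ∀ (m n : ℕ) (B : ℝ),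
    (∀ p, |LPu ρ m (LPv ρ n F) p| ≤ B) → ∀ p, |LPu ρ m (LPv ρ n Fu) p| ≤ C * 2 ^ m * B := by
  obtain ⟨C, hC, H⟩ := bern1 hρ
  refine ⟨C, hC, fun F Fu hF hFu hd m n B hB p => ?_⟩
  obtain ⟨D, Di, DC, hD⟩ := H m
  have := hD (fun a => LPv ρ n F (a, p.2)) (fun a => LPv ρ n Fu (a, p.2))
    ((LPv_bc hρ n hF).comp (by fun_prop)) ((LPv_bc hρ n hFu).comp (by fun_prop))
    (fun x => ker_deriv (ker_int hρ n) (f := fun q => F (q.1, p.2 - q.2))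
      (f' := fun q => Fu (q.1, p.2 - q.2))
      (hF.comp (by fun_prop)) (hFu.comp (by fun_prop)) (fun x y => hd x (p.2 - y)) x) p.1
  change LPu ρ m (LPv ρ n Fu) p = _ at this
  rw [this]
  refine (int_bd Di (M := B) fun y => hB (p.1 - y, p.2)).trans ?_
  have : 0 ≤ B := (abs_nonneg _).trans (hB 0)
  gcongr

lemma bern_v {ρ : ℝ → ℝ} (hρ : IsLPCutoff ρ) : ∃ C : ℝ, 0 < C ∧ ∀ (F Fv : ℝ × ℝ → ℝ), BC F → BC Fv →
    (∀ x y, HasDerivAt (fun a => F (x, a)) (Fv (x, y)) y) → ∀ (m n : ℕ) (B : ℝ),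
    (∀ p, |LPu ρ m (LPv ρ n F) p| ≤ B) → ∀ p, |LPu ρ m (LPv ρ n Fv) p| ≤ C * 2 ^ n * B := by
  obtain ⟨C, hC, H⟩ := bern1 hρ
  refine ⟨C, hC, fun F Fv hF hFv hd m n B hB p => ?_⟩
  obtain ⟨D, Di, DC, hD⟩ := H n
  have e : ∀ q : ℝ × ℝ, LPv ρ n Fv q = ∫ y, D y * LPv ρ n F (q.1, q.2 - y) := by
    intro q
    exact hD (fun a => F (q.1, a)) (fun a => Fv (q.1, a)) (hF.comp (by fun_prop))
      (hFv.comp (by fun_prop)) (fun x => hd q.1 x) q.2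
  have e2 : LPu ρ m (LPv ρ n Fv) p = ∫ y, D y * LPu ρ m (LPv ρ n F) (p.1, p.2 - y) := by
    unfold LPu
    simp_rw [e]
    exact swap0 (ker_int hρ m) Di (W := fun r => LPv ρ n F (p.1 - r.1, p.2 - r.2))
      ((LPv_bc hρ n hF).comp (by fun_prop))
  rw [e2]
  refine (int_bd Di (M := B) fun y => hB (p.1, p.2 - y)).trans ?_
  have : 0 ≤ B := (abs_nonneg _).trans (hB 0)
  gcongr

lemma sum1 {ρ : ℝ → ℝ} (hρ : IsLPCutoff ρ) (L : ℕ) {h : ℝ → ℝ} (hh : BC h) (x : ℝ) :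
    ∑ k ∈ Finset.range (L + 1), LP ρ k h x = ∫ y, invFourier ρ y * h (x - y / 2 ^ L) := by
  unfold LP
  rw [← integral_finsetSum _ fun k _ =>
    int_ker_bc (ker_int hρ k) (hh.comp (s := fun y => x - y) (by fun_prop))]
  simp_rw [← Finset.sum_mul, ker_sum hρ]
  have hp : (0:ℝ) < 2 ^ L := by positivity
  have := Measure.integral_comp_mul_left (fun y : ℝ => invFourier ρ y * h (x - y / 2 ^ L)) (2 ^ L)
  rw [abs_of_pos (by positivity), smul_eq_mul] at this
  have e : (∫ y, invFourier ρ y * h (x - y / 2 ^ L)) =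
     2 ^ L * ∫ y, (invFourier ρ (2 ^ L * y) * h (x - 2 ^ L * y / 2 ^ L)) := by
    rw [this]; field_simp
  rw [e, ← integral_const_mul]
  refine integral_congr_ae (Filter.Eventually.of_forall fun y => ?_)
  simp only
  rw [mul_div_cancel_left₀ _ hp.ne']; ring

lemma sum2 {ρ : ℝ → ℝ} (hρ : IsLPCutoff ρ) (L : ℕ) {G : ℝ × ℝ → ℝ} (hG : BC G) (p : ℝ × ℝ) :
    ∑ m ∈ Finset.range (L + 1), ∑ n ∈ Finset.range (L + 1), LPu ρ m (LPv ρ n G) p =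
      ∫ a, invFourier ρ a * ∫ b, invFourier ρ b * G (p.1 - a / 2 ^ L, p.2 - b / 2 ^ L) := by
  rw [Finset.sum_comm]
  have e1 : ∀ n, ∑ m ∈ Finset.range (L + 1), LPu ρ m (LPv ρ n G) p =
      ∫ a, invFourier ρ a * LPv ρ n G (p.1 - a / 2 ^ L, p.2) := fun n =>
    sum1 hρ L (h := fun a => LPv ρ n G (a, p.2)) ((LPv_bc hρ n hG).comp (by fun_prop)) p.1
  simp_rw [e1]
  rw [← integral_finsetSum _ fun k _ => int_ker_bc hρ.good.integrable_ker
    ((LPv_bc hρ k hG).comp (s := fun a : ℝ => (p.1 - a / 2 ^ L, p.2)) (by fun_prop))]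
  refine integral_congr_ae (Filter.Eventually.of_forall fun a => ?_)
  simp only
  rw [← Finset.mul_sum]
  congr 1
  exact sum1 hρ L (h := fun b => G (p.1 - a / 2 ^ L, b)) (hG.comp (by fun_prop)) p.2

lemma LP_tendsto {ρ : ℝ → ℝ} (hρ : IsLPCutoff ρ) (K : ℕ) {G : ℝ × ℝ → ℝ} (hG : BC G) (t x : ℝ) :
    Filter.Tendsto (fun L : ℕ => ∑ m ∈ Finset.range (L + 1), ∑ n ∈ Finset.range (L + 1),
      LP ρ K (fun x => LPu ρ m (LPv ρ n G) (x - t, x + t)) x) Filter.atTop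
      (nhds (2 * π * LP ρ K (fun x => G (x - t, x + t)) x)) := by
  have φi := hρ.good.integrable_ker
  obtain ⟨hc, M, hM⟩ := hG
  have hG : BC G := ⟨hc, M, hM⟩
  set E : ℕ → ℝ × ℝ → ℝ := fun L p => ∫ a, invFourier ρ a * ∫ b, invFourier ρ b *
    G (p.1 - a / 2 ^ L, p.2 - b / 2 ^ L) with hE
  have i1 : ∀ L : ℕ, BC (fun q : (ℝ × ℝ) × ℝ => ∫ b, invFourier ρ b *
      G (q.1.1 - q.2 / 2 ^ L, q.1.2 - b / 2 ^ L)) := fun L =>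
    BC.integral φi (H := fun r : ((ℝ × ℝ) × ℝ) × ℝ => G (r.1.1.1 - r.1.2 / 2 ^ L, r.1.1.2 - r.2 / 2 ^ L))
      (hG.comp (by fun_prop))
  have Ec : ∀ L, Continuous (E L) := fun L => (BC.integral φi (i1 L)).1
  have Eb : ∀ L p, |E L p| ≤ (∫ y, |invFourier ρ y|) * ((∫ y, |invFourier ρ y|) * M) :=
    fun L p => int_bd φi fun a => int_bd φi fun b => hM _
  have tl : ∀ a c : ℝ, Filter.Tendsto (fun L : ℕ => c - a / 2 ^ L) Filter.atTop (nhds c) := by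
    intro a c
    have h1 : Filter.Tendsto (fun L : ℕ => a * (1 / 2 : ℝ) ^ L) Filter.atTop (nhds (a * 0)) :=
      (tendsto_pow_atTop_nhds_zero_of_lt_one (by norm_num) (by norm_num)).const_mul a
    have h2 := h1.const_sub c
    rw [mul_zero, sub_zero] at h2
    refine h2.congr fun L => ?_
    rw [one_div, inv_pow, div_eq_mul_inv]
  have El : ∀ p, Filter.Tendsto (fun L => E L p) Filter.atTop (nhds (2 * π * G p)) := by
    intro p
    have h1 : ∀ a : ℝ, Filter.Tendsto (fun L : ℕ => ∫ b, invFourier ρ b *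
        G (p.1 - a / 2 ^ L, p.2 - b / 2 ^ L)) Filter.atTop (nhds (∫ b, invFourier ρ b * G p)) := by
      intro a
      refine ker_dct φi (M := M) (fun L => hc.comp (by fun_prop)) (fun L y => hM _) fun b => ?_
      exact (hc.tendsto p).comp ((tl a p.1).prodMk_nhds (tl b p.2))
    have h2 := ker_dct φi (M := (∫ y, |invFourier ρ y|) * M)
      (h := fun L a => ∫ b, invFourier ρ b * G (p.1 - a / 2 ^ L, p.2 - b / 2 ^ L))
      (fun L => ((i1 L).comp (s := fun a => (p, a)) (by fun_prop)).1)
      (fun L a => int_bd φi fun b => hM _) h1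
    convert h2 using 2
    rw [integral_mul_const, integral_mul_const, int_phi hρ, ← s2p_sq]; ring
  have key := ker_dct (ker_int hρ K) (h := fun L y => E L (x - y - t, x - y + t))
    (fun L => (Ec L).comp (by fun_prop)) (fun L y => Eb L _) fun y => El (x - y - t, x - y + t)
  have e0 : ∫ y, lpKernel ρ K y * (2 * π * G (x - y - t, x - y + t)) =
      2 * π * LP ρ K (fun x => G (x - t, x + t)) x := by
    unfold LP
    rw [← integral_const_mul]
    refine integral_congr_ae (Filter.Eventually.of_forall fun y => ?_)
    simp only; ring
  rw [e0] at key
  refine key.congr fun L => ?_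
  have hEs : ∀ p, E L p = ∑ m ∈ Finset.range (L + 1), ∑ n ∈ Finset.range (L + 1),
      LPu ρ m (LPv ρ n G) p := fun p => (sum2 hρ L hG p).symm
  simp_rw [hEs]
  unfold LP
  have i3 : ∀ m n : ℕ, Integrable (fun y => lpKernel ρ K y *
      LPu ρ m (LPv ρ n G) (x - y - t, x - y + t)) := fun m n =>
    int_ker_bc (ker_int hρ K) ((LPu_bc hρ m (LPv_bc hρ n hG)).comp
      (s := fun y => (x - y - t, x - y + t)) (by fun_prop))
  simp_rw [Finset.mul_sum]
  rw [integral_finsetSum _ fun m _ => integrable_finsetSum _ fun n _ => i3 m n]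
  exact Finset.sum_congr rfl fun m _ => integral_finsetSum _ fun n _ => i3 m n


/-- the weight `(2^m)^(-a)` -/
def wt (a : ℝ) (m : ℕ) : ℝ := (2 : ℝ) ^ (-(a * (m : ℝ)))

lemma wt_pos (a : ℝ) (m : ℕ) : 0 < wt a m := by unfold wt; positivity

lemma wt_mul (a b : ℝ) (m : ℕ) : wt a m * wt b m = wt (a + b) m := by
  unfold wt; rw [← Real.rpow_add two_pos]; congr 1; ring

lemma wt_mono {a b : ℝ} (h : a ≤ b) (m : ℕ) : wt b m ≤ wt a m := by
  unfold wt
  refine Real.rpow_le_rpow_of_exponent_le one_le_two ?_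
  have : (0:ℝ) ≤ m := by positivity
  nlinarith

lemma wt_pow (a : ℝ) (m : ℕ) : wt a m = ((2 : ℝ) ^ (-a)) ^ m := by
  unfold wt; rw [← Real.rpow_mul_natCast two_pos.le]; congr 1; ring

lemma wt_window (a : ℝ) (c : ℕ) {m K : ℕ} (h1 : m ≤ K + c) (h2 : K ≤ m + c) :
    wt a m ≤ (2 : ℝ) ^ (|a| * c) * wt a K := by
  unfold wt
  rw [← Real.rpow_add two_pos]
  refine Real.rpow_le_rpow_of_exponent_le one_le_two ?_
  have h1' : (m : ℝ) ≤ K + c := by exact_mod_cast h1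
  have h2' : (K : ℝ) ≤ m + c := by exact_mod_cast h2
  have : a * ((K : ℝ) - m) ≤ |a| * c := by
    refine (le_abs_self _).trans ?_
    rw [abs_mul]
    refine mul_le_mul_of_nonneg_left ?_ (abs_nonneg _)
    rw [abs_le]; constructor <;> linarith
  linarith

lemma sum_window (a : ℝ) (c : ℕ) : ∃ C : ℝ, 0 < C ∧ ∀ (K : ℕ) (s : Finset ℕ),
    ∑ m ∈ s, (if m ≤ K + c ∧ K ≤ m + c then wt a m else 0) ≤ C * wt a K := by
  refine ⟨(2 * c + 1 : ℕ) * (2 : ℝ) ^ (|a| * c), by positivity, fun K s => ?_⟩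
  rw [← Finset.sum_filter]
  have hb : ∀ m ∈ s.filter (fun m => m ≤ K + c ∧ K ≤ m + c), wt a m ≤
      (2 : ℝ) ^ (|a| * c) * wt a K := by
    intro m hm
    rw [Finset.mem_filter] at hm
    exact wt_window a c hm.2.1 hm.2.2
  refine (Finset.sum_le_card_nsmul _ _ _ hb).trans ?_
  rw [nsmul_eq_mul, mul_assoc]
  have hp : 0 ≤ (2 : ℝ) ^ (|a| * c) * wt a K := by have := wt_pos a K; positivity
  refine mul_le_mul_of_nonneg_right ?_ hp
  have : (s.filter (fun m => m ≤ K + c ∧ K ≤ m + c)) ⊆ Finset.Icc (K - c) (K + c) := by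
    intro m hm
    rw [Finset.mem_filter] at hm
    rw [Finset.mem_Icc]; omega
  have h2 := Finset.card_le_card this
  rw [Nat.card_Icc] at h2
  exact_mod_cast h2.trans (by omega)

lemma sum_low {b : ℝ} (hb : b ≠ 0) : ∃ C : ℝ, 0 < C ∧ ∀ (K : ℕ) (s : Finset ℕ),
    ∑ n ∈ s, (if n ≤ K then wt b n else 0) ≤ C * (1 + wt b K) := by
  set r : ℝ := (2 : ℝ) ^ (-b) with hr
  have r0 : 0 < r := by positivity
  have r1 : r ≠ 1 := by
    intro h
    rcases lt_or_gt_of_ne hb with h' | h'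
    · have := Real.one_lt_rpow (x := 2) one_lt_two (show 0 < -b by linarith); linarith
    · have := Real.rpow_lt_one_of_one_lt_of_neg (x := 2) one_lt_two (show -b < 0 by linarith); linarith
  have rp : 0 < |1 - r| := abs_pos.2 (sub_ne_zero.2 r1.symm)
  refine ⟨(1 + r) / |1 - r|, by positivity, fun K s => ?_⟩
  have h1 : ∑ n ∈ s, (if n ≤ K then wt b n else 0) ≤ ∑ n ∈ Finset.range (K + 1), r ^ n := by
    rw [← Finset.sum_filter]
    simp_rw [wt_pow]
    refine Finset.sum_le_sum_of_subset_of_nonneg ?_ fun i _ _ => by positivity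
    intro m hm
    rw [Finset.mem_filter] at hm
    rw [Finset.mem_range]; omega
  refine h1.trans ?_
  rw [geom_sum_eq r1, wt_pow, ← hr, pow_succ]
  have rK : 0 < r ^ K := by positivity
  rcases lt_or_gt_of_ne r1 with h | h
  · rw [abs_of_pos (by linarith), ← neg_div_neg_eq, neg_sub, neg_sub, div_mul_eq_mul_div]
    refine div_le_div_of_nonneg_right ?_ (by linarith)
    nlinarith [mul_pos rK r0]
  · rw [abs_of_neg (by linarith), neg_sub, div_mul_eq_mul_div]
    refine div_le_div_of_nonneg_right ?_ (by linarith)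
    nlinarith [mul_pos rK r0]

lemma sum_high {d : ℝ} (hd : 0 < d) : ∃ C : ℝ, 0 < C ∧ ∀ (K : ℕ) (s : Finset ℕ),
    ∑ m ∈ s, (if K ≤ m + 12 then wt d m else 0) ≤ C * wt d K := by
  set r : ℝ := (2 : ℝ) ^ (-d) with hr
  have r0 : 0 < r := by positivity
  have r1 : r < 1 := Real.rpow_lt_one_of_one_lt_of_neg (x := 2) one_lt_two (show -d < 0 by linarith)
  refine ⟨(r ^ 12)⁻¹ * (1 - r)⁻¹, by have : 0 < 1 - r := by linarith
                                     positivity, fun K s => ?_⟩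
  rw [← Finset.sum_filter]
  have e : ∀ m ∈ s.filter (fun m => K ≤ m + 12), wt d m =
      (r ^ 12)⁻¹ * wt d K * r ^ (m + 12 - K) := by
    intro m hm
    rw [Finset.mem_filter] at hm
    rw [wt_pow, wt_pow, ← hr, mul_assoc, ← pow_add, show K + (m + 12 - K) = m + 12 by omega, pow_add]
    field_simp
  rw [Finset.sum_congr rfl e, ← Finset.mul_sum]
  have h2 : ∑ m ∈ s.filter (fun m => K ≤ m + 12), r ^ (m + 12 - K) ≤ (1 - r)⁻¹ := by
    rw [← tsum_geometric_of_lt_one r0.le r1,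
      ← Finset.sum_image (f := fun j => r ^ j) (g := fun m => m + 12 - K)]
    · exact (summable_geometric_of_lt_one r0.le r1).sum_le_tsum _ fun i _ => by positivity
    · intro x hx y hy hxy
      simp only [Finset.coe_filter, Set.mem_ofPred_eq] at hx hy hxy
      omega
  have hp : 0 ≤ (r ^ 12)⁻¹ * wt d K := by have := wt_pos d K; positivity
  calc _ ≤ (r ^ 12)⁻¹ * wt d K * (1 - r)⁻¹ := mul_le_mul_of_nonneg_left h2 hp
    _ = _ := by ring

lemma sum_close (α β : ℝ) (h : 0 < α + β) : ∃ C : ℝ, 0 < C ∧ ∀ (K : ℕ) (s : Finset ℕ),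
    ∑ m ∈ s, ∑ n ∈ s, (if K ≤ m + 12 then wt α m else 0) *
      (if n ≤ m + 10 ∧ m ≤ n + 10 then wt β n else 0) ≤ C * wt (α + β) K := by
  obtain ⟨C1, hC1, H1⟩ := sum_window β 10
  obtain ⟨C2, hC2, H2⟩ := sum_high h
  refine ⟨C1 * C2, by positivity, fun K s => ?_⟩
  calc _ ≤ ∑ m ∈ s, C1 * (if K ≤ m + 12 then wt (α + β) m else 0) := by
        refine Finset.sum_le_sum fun m _ => ?_
        rw [← Finset.mul_sum]
        split_ifs with hk
        · rw [← wt_mul]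
          have := mul_le_mul_of_nonneg_left (H1 m s) (wt_pos α m).le
          calc _ ≤ _ := this
            _ = _ := by ring
        · simp
    _ ≤ _ := by
        rw [← Finset.mul_sum, mul_assoc]
        exact mul_le_mul_of_nonneg_left (H2 K s) hC1.le

lemma sum_bound (α β γ : ℝ) (hα : α ≠ 0) (hβ : β ≠ 0) (h1 : γ ≤ α) (h2 : γ ≤ β) (h3 : γ ≤ α + β) :
    ∃ C : ℝ, 0 < C ∧ ∀ (K : ℕ) (A : ℝ) (T : ℕ → ℕ → ℝ), 0 ≤ A →
      (∀ m n, |T m n| ≤ A * (wt α m * wt β n)) →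
      (∀ m n, ((m + 2 < K ∧ n + 2 < K) ∨ (n + 10 ≤ m ∧ K + 1 < m) ∨ (m + 10 ≤ n ∧ K + 1 < n)) →
        T m n = 0) →
      (0 < α + β ∨ ∀ m n, m < n + 10 → n < m + 10 → T m n = 0) →
      ∀ s : Finset ℕ, |∑ m ∈ s, ∑ n ∈ s, T m n| ≤ C * A * wt γ K := by
  obtain ⟨Ca, hCa, Ha⟩ := sum_window α 2
  obtain ⟨Cb, hCb, Hb⟩ := sum_window β 2
  obtain ⟨La, hLa, Hla⟩ := sum_low hα
  obtain ⟨Lb, hLb, Hlb⟩ := sum_low hβ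
  obtain ⟨Cc, hCc, Hc⟩ : ∃ C : ℝ, 0 < C ∧ ∀ (K : ℕ) (s : Finset ℕ),
      (if 0 < α + β then ∑ m ∈ s, ∑ n ∈ s, (if K ≤ m + 12 then wt α m else 0) *
      (if n ≤ m + 10 ∧ m ≤ n + 10 then wt β n else 0) else 0) ≤ C * wt (α + β) K := by
    by_cases h : 0 < α + β
    · simpa [h] using sum_close α β h
    · exact ⟨1, one_pos, fun K s => by simp only [h, if_false, one_mul]; exact (wt_pos _ _).le⟩
  refine ⟨2 * Ca * Lb + 2 * La * Cb + Cc, by positivity, ?_⟩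
  intro K A T hA hT hz hc s
  set a1 : ℕ → ℝ := fun m => if m ≤ K + 2 ∧ K ≤ m + 2 then wt α m else 0 with ha1
  set b1 : ℕ → ℝ := fun m => if m ≤ K + 2 ∧ K ≤ m + 2 then wt β m else 0 with hb1
  set a2 : ℕ → ℝ := fun m => if m ≤ K then wt α m else 0 with ha2
  set b2 : ℕ → ℝ := fun m => if m ≤ K then wt β m else 0 with hb2
  set c1 : ℕ → ℝ := fun m => if K ≤ m + 12 then wt α m else 0 with hc1
  set c2 : ℕ → ℕ → ℝ := fun m n => if n ≤ m + 10 ∧ m ≤ n + 10 then wt β n else 0 with hc2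
  have pos : ∀ (P : Prop) [Decidable P] (x : ℝ), 0 ≤ x → 0 ≤ if P then x else 0 := by
    intro P _ x hx; split_ifs <;> simp [hx]
  have a1p : ∀ m, 0 ≤ a1 m := fun m => pos _ _ (wt_pos _ _).le
  have a2p : ∀ m, 0 ≤ a2 m := fun m => pos _ _ (wt_pos _ _).le
  have b1p : ∀ m, 0 ≤ b1 m := fun m => pos _ _ (wt_pos _ _).le
  have b2p : ∀ m, 0 ≤ b2 m := fun m => pos _ _ (wt_pos _ _).le
  have c1p : ∀ m, 0 ≤ c1 m := fun m => pos _ _ (wt_pos _ _).le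
  have c2p : ∀ m n, 0 ≤ c2 m n := fun m n => pos _ _ (wt_pos _ _).le
  have term : ∀ m n, |T m n| ≤ A * (a1 m * b2 n + a2 m * b1 n +
      if 0 < α + β then c1 m * c2 m n else 0) := by
    intro m n
    have q1 := mul_nonneg (a1p m) (b2p n)
    have q2 := mul_nonneg (a2p m) (b1p n)
    have q3 : 0 ≤ if 0 < α + β then c1 m * c2 m n else 0 :=
      pos _ _ (mul_nonneg (c1p m) (c2p m n))
    by_cases h0 : T m n = 0
    · rw [h0, abs_zero]; positivity
    have hn : ¬ ((m + 2 < K ∧ n + 2 < K) ∨ (n + 10 ≤ m ∧ K + 1 < m) ∨ (m + 10 ≤ n ∧ K + 1 < n)) :=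
      fun h => h0 (hz m n h)
    refine (hT m n).trans (mul_le_mul_of_nonneg_left ?_ hA)
    by_cases hm : n + 10 ≤ m
    · have e1 : a1 m = wt α m := if_pos (by omega)
      have e2 : b2 n = wt β n := if_pos (by omega)
      rw [← e1, ← e2]; linarith
    by_cases hn' : m + 10 ≤ n
    · have e1 : a2 m = wt α m := if_pos (by omega)
      have e2 : b1 n = wt β n := if_pos (by omega)
      rw [← e1, ← e2]; linarith
    rcases hc with hc | hc
    · have e1 : c1 m = wt α m := if_pos (by omega)
      have e2 : c2 m n = wt β n := if_pos (by omega)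
      rw [if_pos hc] at q3 ⊢
      rw [← e1, ← e2]; linarith
    · exact absurd (hc m n (by omega) (by omega)) h0
  have w1 := wt_mono h1 K
  have w2 := wt_mono h2 K
  have w3 := wt_mono h3 K
  have S1 : (∑ m ∈ s, a1 m) * (∑ n ∈ s, b2 n) ≤ (2 * Ca * Lb) * wt γ K := by
    have := mul_le_mul (Ha K s) (Hlb K s) (Finset.sum_nonneg fun n _ => b2p n)
      (mul_nonneg hCa.le (wt_pos _ _).le)
    refine this.trans ?_
    have e : Ca * wt α K * (Lb * (1 + wt β K)) = Ca * Lb * (wt α K + wt (α + β) K) := by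
      rw [← wt_mul]; ring
    rw [e]
    have : 0 < Ca * Lb := by positivity
    nlinarith
  have S2 : (∑ m ∈ s, a2 m) * (∑ n ∈ s, b1 n) ≤ (2 * La * Cb) * wt γ K := by
    have := mul_le_mul (Hla K s) (Hb K s) (Finset.sum_nonneg fun n _ => b1p n)
      (mul_nonneg hLa.le (by have := wt_pos α K; linarith))
    refine this.trans ?_
    have e : La * (1 + wt α K) * (Cb * wt β K) = La * Cb * (wt β K + wt (α + β) K) := by
      rw [← wt_mul]; ring
    rw [e]
    have : 0 < La * Cb := by positivity
    nlinarith
  have S3 : (if 0 < α + β then ∑ m ∈ s, ∑ n ∈ s, c1 m * c2 m n else 0) ≤ Cc * wt γ K :=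
    (Hc K s).trans (mul_le_mul_of_nonneg_left w3 hCc.le)
  calc |∑ m ∈ s, ∑ n ∈ s, T m n| ≤ ∑ m ∈ s, ∑ n ∈ s, |T m n| :=
        (Finset.abs_sum_le_sum_abs _ _).trans
          (Finset.sum_le_sum fun m _ => Finset.abs_sum_le_sum_abs _ _)
    _ ≤ ∑ m ∈ s, ∑ n ∈ s, A * (a1 m * b2 n + a2 m * b1 n +
      if 0 < α + β then c1 m * c2 m n else 0) :=
        Finset.sum_le_sum fun m _ => Finset.sum_le_sum fun n _ => term m n
    _ = A * ((∑ m ∈ s, a1 m) * (∑ n ∈ s, b2 n) + (∑ m ∈ s, a2 m) * (∑ n ∈ s, b1 n) +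
          if 0 < α + β then ∑ m ∈ s, ∑ n ∈ s, c1 m * c2 m n else 0) := by
        simp_rw [← Finset.mul_sum, Finset.sum_add_distrib, Finset.sum_mul_sum]
        by_cases h0 : 0 < α + β
        · simp only [h0, if_true, Finset.mul_sum]
        · simp only [h0, if_false, Finset.sum_const_zero]
    _ ≤ A * ((2 * Ca * Lb) * wt γ K + (2 * La * Cb) * wt γ K + Cc * wt γ K) := by gcongr
    _ = _ := by ring

lemma trace_bound {ρ : ℝ → ℝ} (hρ : IsLPCutoff ρ) (α β γ : ℝ) (hα : α ≠ 0) (hβ : β ≠ 0)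
    (h1 : γ ≤ α) (h2 : γ ≤ β) (h3 : γ ≤ α + β) :
    ∃ C : ℝ, 0 < C ∧ ∀ (G : ℝ × ℝ → ℝ) (A : ℝ), BC G → 0 ≤ A →
      (∀ m n p, |LPu ρ m (LPv ρ n G) p| ≤ A * (wt α m * wt β n)) →
      (0 < α + β ∨ ∀ m n, m < n + 10 → n < m + 10 → ∀ p, LPu ρ m (LPv ρ n G) p = 0) →
      ∀ (K : ℕ) (t x : ℝ), |LP ρ K (fun x => G (x - t, x + t)) x| ≤ C * A * wt γ K := by
  obtain ⟨C0, hC0, H0⟩ := ker_L1 (ρ := ρ)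
  obtain ⟨C1, hC1, H1⟩ := sum_bound α β γ hα hβ h1 h2 h3
  refine ⟨C1 * C0, by positivity, ?_⟩
  intro G A hG hA hb hz K t x
  have lim := (LP_tendsto hρ K hG t x).abs
  have le : |2 * π * LP ρ K (fun x => G (x - t, x + t)) x| ≤ C1 * (C0 * A) * wt γ K := by
    refine le_of_tendsto lim (Filter.Eventually.of_forall fun L => ?_)
    refine H1 K (C0 * A) (fun m n => LP ρ K (fun x => LPu ρ m (LPv ρ n G) (x - t, x + t)) x)
      (by positivity) ?_ ?_ ?_ _
    · intro m n
      refine (int_bd (ker_int hρ K) (M := A * (wt α m * wt β n)) fun y => hb m n _).trans ?_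
      rw [mul_assoc]
      have := wt_pos α m
      have := wt_pos β n
      exact mul_le_mul_of_nonneg_right (H0 K) (by positivity)
    · intro m n h
      exact LP_vanish hρ h hG t x
    · refine hz.imp id fun h m n hm hn => ?_
      simp only [LP, h m n hm hn, mul_zero, integral_zero]
  rw [abs_mul, abs_of_pos (by positivity)] at le
  have hpi : 1 ≤ 2 * π := by linarith [Real.pi_gt_three]
  have := abs_nonneg (LP ρ K (fun x => G (x - t, x + t)) x)
  calc _ ≤ 2 * π * |LP ρ K (fun x => G (x - t, x + t)) x| := by nlinarith
    _ ≤ _ := le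
    _ = _ := by ring

lemma wt_inv (a : ℝ) (k : ℕ) : ((2 : ℝ) ^ k) ^ a * wt a k = 1 := by
  unfold wt
  rw [← Real.rpow_natCast_mul two_pos.le, ← Real.rpow_add two_pos]
  convert Real.rpow_zero 2 using 2
  ring

lemma two_pow_wt (a : ℝ) (k : ℕ) : 2 ^ k * wt a k = wt (a - 1) k := by
  unfold wt
  rw [← Real.rpow_natCast, ← Real.rpow_add two_pos]
  congr 1; ring

lemma hNorm_le {ρ : ℝ → ℝ} {γ B : ℝ} {f : ℝ → ℝ} (hB : 0 ≤ B)
    (h : ∀ K x, |LP ρ K f x| ≤ B * wt γ K) : hNorm ρ γ f ≤ ENNReal.ofReal B := by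
  unfold hNorm
  refine iSup_le fun k => ?_
  calc _ ≤ ENNReal.ofReal (((2 : ℝ) ^ k) ^ γ) * ENNReal.ofReal (B * wt γ k) := by
        gcongr
        exact iSup_le fun x => ENNReal.ofReal_le_ofReal (h k x)
    _ = _ := by
        rw [← ENNReal.ofReal_mul (by positivity)]
        congr 1
        calc _ = B * (((2 : ℝ) ^ k) ^ γ * wt γ k) := by ring
          _ = B := by rw [wt_inv, mul_one]

lemma hNorm2_bd {ρ : ℝ → ℝ} {α β : ℝ} {F : ℝ × ℝ → ℝ} (h : hNorm2 ρ α β F ≠ ∞) (m n : ℕ) (p : ℝ × ℝ) :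
    |LPu ρ m (LPv ρ n F) p| ≤ (hNorm2 ρ α β F).toReal * (wt α m * wt β n) := by
  have h1 : ENNReal.ofReal (((2 : ℝ) ^ m) ^ α * ((2 : ℝ) ^ n) ^ β) *
      ENNReal.ofReal |LPu ρ m (LPv ρ n F) p| ≤ hNorm2 ρ α β F := by
    unfold hNorm2
    refine le_trans ?_ (le_iSup_of_le m (le_iSup_of_le n le_rfl))
    gcongr
    exact le_iSup (fun p => ENNReal.ofReal |LPu ρ m (LPv ρ n F) p|) p
  rw [← ENNReal.ofReal_mul (by positivity), ENNReal.ofReal_le_iff_le_toReal h] at h1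
  have := wt_pos α m
  have := wt_pos β n
  calc _ = (((2 : ℝ) ^ m) ^ α * wt α m) * (((2 : ℝ) ^ n) ^ β * wt β n) * |LPu ρ m (LPv ρ n F) p| := by
        rw [wt_inv, wt_inv]; ring
    _ = (((2 : ℝ) ^ m) ^ α * ((2 : ℝ) ^ n) ^ β * |LPu ρ m (LPv ρ n F) p|) * (wt α m * wt β n) := by ring
    _ ≤ _ := by gcongr

lemma dclose_of {m n : ℕ} (h1 : m < n + 10) (h2 : n < m + 10) : DClose m n := by
  constructor
  · rw [div_lt_iff₀ (by positivity), ← pow_add]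
    exact pow_lt_pow_right₀ (by norm_num) h2
  · rw [← pow_add]
    exact pow_lt_pow_right₀ (by norm_num) (by omega)


/-- **Corollary 2.19: from null to Cartesian coordinates.**
For `f(t,x) = F(x−t, x+t)`, under either (i) `γ ≤ min (α, β)` and `α + β > 1`, or (ii)
`γ ≤ min (α, β, α+β)` and `P_M^u P_N^v F = 0` for all `M ∼ N`, one has
`‖f‖_{C_t^0 C_x^γ} + ‖f‖_{C_t^1 C_x^{γ−1}} ≲ ‖F‖_{C_u^{α}C_v^{β}}`. -/
theorem null_to_cartesian
    (ρ : ℝ → ℝ) (hρ : IsLPCutoff ρ)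
    (α β γ : ℝ) (hα0 : α ≠ 0) (hα1 : α ≠ 1) (hβ0 : β ≠ 0) (hβ1 : β ≠ 1) :
    ∃ C : ℝ≥0∞, C ≠ ∞ ∧ ∀ F : ℝ × ℝ → ℝ, CbSmooth F →
      ((γ ≤ min α β ∧ 1 < α + β) ∨
        (γ ≤ min α (min β (α + β)) ∧
          ∀ m n : ℕ, DClose m n → ∀ p, LPu ρ m (LPv ρ n F) p = 0)) →
      (⨆ t : ℝ, hNorm ρ γ fun x => F (x - t, x + t)) +
          (⨆ t : ℝ, hNorm ρ (γ - 1) fun x => deriv (fun t' => F (x - t', x + t')) t) ≤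
        C * hNorm2 ρ α β F := by
  have c1 : 0 < 1 := one_pos
  by_cases hcase : γ ≤ α ∧ γ ≤ β ∧ γ ≤ α + β
  swap
  · -- the hypotheses are contradictory
    refine ⟨1, by simp, fun F hF h => absurd ?_ hcase⟩
    rcases h with ⟨h1, h2⟩ | ⟨h1, -⟩
    · rw [le_min_iff] at h1
      refine ⟨h1.1, h1.2, ?_⟩
      by_cases ha : 0 ≤ α
      · linarith
      · linarith
    · rw [le_min_iff, le_min_iff] at h1
      exact ⟨h1.1, h1.2.1, h1.2.2⟩
  obtain ⟨g1, g2, g3⟩ := hcase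
  obtain ⟨Cu, hCu, Hu⟩ := bern_u hρ
  obtain ⟨Cv, hCv, Hv⟩ := bern_v hρ
  obtain ⟨T0, hT0, HT0⟩ := trace_bound hρ α β γ hα0 hβ0 g1 g2 g3
  obtain ⟨T1, hT1, HT1⟩ := trace_bound hρ (α - 1) β (γ - 1) (sub_ne_zero.2 hα1) hβ0
    (by linarith) (by linarith) (by linarith)
  obtain ⟨T2, hT2, HT2⟩ := trace_bound hρ α (β - 1) (γ - 1) hα0 (sub_ne_zero.2 hβ1)
    (by linarith) (by linarith) (by linarith)
  refine ⟨ENNReal.ofReal (T0 + (T1 * Cu + T2 * Cv)), ENNReal.ofReal_ne_top, fun F hF hyp => ?_⟩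
  by_cases hfin : hNorm2 ρ α β F = ∞
  · rw [hfin, ENNReal.mul_top]
    · exact le_top
    · rw [ne_eq, ENNReal.ofReal_eq_zero, not_le]; positivity
  set A : ℝ := (hNorm2 ρ α β F).toReal with hA
  have A0 : 0 ≤ A := ENNReal.toReal_nonneg
  have hbd := hNorm2_bd hfin
  -- regularity
  obtain ⟨hsm, hbnd⟩ := hF
  have hdiff : Differentiable ℝ F := hsm.differentiable (by simp)
  have bF : BC F := by
    refine ⟨hsm.continuous, ?_⟩
    obtain ⟨C, hC⟩ := hbnd 0
    exact ⟨C, fun p => by simpa using hC p⟩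
  have bdir : ∀ e : ℝ × ℝ, BC (fun p => fderiv ℝ F p e) := by
    intro e
    refine ⟨(hsm.continuous_fderiv (by simp)).clm_apply continuous_const, ?_⟩
    obtain ⟨C, hC⟩ := hbnd 1
    refine ⟨C * ‖e‖, fun p => ?_⟩
    have h1 := hC p
    rw [norm_iteratedFDeriv_one] at h1
    exact ((fderiv ℝ F p).le_opNorm e).trans (mul_le_mul_of_nonneg_right h1 (norm_nonneg _))
  set Fu : ℝ × ℝ → ℝ := fun p => fderiv ℝ F p (1, 0) with hFu
  set Fv : ℝ × ℝ → ℝ := fun p => fderiv ℝ F p (0, 1) with hFv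
  have bFu : BC Fu := bdir _
  have bFv : BC Fv := bdir _
  have du : ∀ x y, HasDerivAt (fun a => F (a, y)) (Fu (x, y)) x := fun x y =>
    (hdiff (x, y)).hasFDerivAt.comp_hasDerivAt x
      ((hasDerivAt_id x).prodMk (hasDerivAt_const x y))
  have dv : ∀ x y, HasDerivAt (fun a => F (x, a)) (Fv (x, y)) y := fun x y =>
    (hdiff (x, y)).hasFDerivAt.comp_hasDerivAt y
      ((hasDerivAt_const y x).prodMk (hasDerivAt_id y))
  have dt : ∀ x t, deriv (fun t' => F (x - t', x + t')) t =
      Fv (x - t, x + t) - Fu (x - t, x + t) := by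
    intro x t
    have h1 : HasDerivAt (fun t' : ℝ => (x - t', x + t')) ((-1 : ℝ), (1 : ℝ)) t :=
      ((hasDerivAt_id t).const_sub x).prodMk ((hasDerivAt_id t).const_add x)
    have h2 := (hdiff (x - t, x + t)).hasFDerivAt.comp_hasDerivAt t h1
    have h3 : ((-1 : ℝ), (1 : ℝ)) = (0, 1) - (1, 0) := by simp
    rw [h3, map_sub] at h2
    exact h2.deriv
  -- case distinction on the resonant part
  have hz0 : 0 < α + β - 1 ∨ ∀ m n, m < n + 10 → n < m + 10 → ∀ p, LPu ρ m (LPv ρ n F) p = 0 := by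
    rcases hyp with ⟨-, h⟩ | ⟨-, h⟩
    · left; linarith
    · right; exact fun m n h1 h2 => h m n (dclose_of h1 h2)
  have B0 : ∀ K t x, |LP ρ K (fun x => F (x - t, x + t)) x| ≤ T0 * A * wt γ K :=
    HT0 F A bF A0 hbd (hz0.imp (fun h => by linarith) id)
  have B1 : ∀ K t x, |LP ρ K (fun x => Fu (x - t, x + t)) x| ≤ T1 * (Cu * A) * wt (γ - 1) K := by
    refine HT1 Fu (Cu * A) bFu (by positivity) ?_ ?_
    · intro m n p
      refine (Hu F Fu bF bFu du m n _ (hbd m n) p).trans (le_of_eq ?_)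
      rw [← two_pow_wt]; ring
    · refine hz0.imp (fun h => by linarith) fun h m n h1 h2 p => ?_
      have := Hu F Fu bF bFu du m n 0 (fun p => by rw [h m n h1 h2 p, abs_zero]) p
      rw [mul_zero] at this
      exact abs_nonpos_iff.1 this
  have B2 : ∀ K t x, |LP ρ K (fun x => Fv (x - t, x + t)) x| ≤ T2 * (Cv * A) * wt (γ - 1) K := by
    refine HT2 Fv (Cv * A) bFv (by positivity) ?_ ?_
    · intro m n p
      refine (Hv F Fv bF bFv dv m n _ (hbd m n) p).trans (le_of_eq ?_)
      rw [← two_pow_wt]; ring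
    · refine hz0.imp (fun h => by linarith) fun h m n h1 h2 p => ?_
      have := Hv F Fv bF bFv dv m n 0 (fun p => by rw [h m n h1 h2 p, abs_zero]) p
      rw [mul_zero] at this
      exact abs_nonpos_iff.1 this
  have B3 : ∀ t K x, |LP ρ K (fun x => deriv (fun t' => F (x - t', x + t')) t) x| ≤
      ((T1 * Cu + T2 * Cv) * A) * wt (γ - 1) K := by
    intro t K x
    have e : LP ρ K (fun x => deriv (fun t' => F (x - t', x + t')) t) x =
        LP ρ K (fun x => Fv (x - t, x + t)) x - LP ρ K (fun x => Fu (x - t, x + t)) x := by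
      simp_rw [dt]
      unfold LP
      rw [← integral_sub
        (int_ker_bc (ker_int hρ K) (bFv.comp (s := fun y => (x - y - t, x - y + t)) (by fun_prop)))
        (int_ker_bc (ker_int hρ K) (bFu.comp (s := fun y => (x - y - t, x - y + t)) (by fun_prop)))]
      simp_rw [mul_sub]
    rw [e]
    refine (abs_sub _ _).trans ?_
    have := B1 K t x
    have := B2 K t x
    linarith
  have R : hNorm2 ρ α β F = ENNReal.ofReal A := (ENNReal.ofReal_toReal hfin).symm
  rw [R, ← ENNReal.ofReal_mul (by positivity), add_mul, ENNReal.ofReal_add (by positivity) (by positivity)]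
  refine add_le_add (iSup_le fun t => ?_) (iSup_le fun t => ?_)
  · exact hNorm_le (by positivity) fun K x => B0 K t x
  · exact hNorm_le (by positivity) (B3 t)
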